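/- Let Y be a real Banach space that is Hilbert generated, let X be a closed linear subspace of Y, and let A ⊆ X be a bounded subset such that A ∪ {0} is compact in the weak topology of X and 0 is the only weak cluster point of A. Then for every ε > 0 there exist subsets A₁, A₂, A₃, … of A with A = ⋃_{n=1}^{∞} Aₙ such that for every n ∈ ℕ and every x* in the closed unit ball B_{X*} of X*, the set {x ∈ Aₙ : |x*(x)| > ε} has at most n elements. -/

import Mathlib

universe v

open Filter

section

open scoped Cardinal

universe u w

theorem Cardinal.lift_mk_biUnion_le_of_countable {H : Type u} {ι : Type w} (D : Set H)
    (s : H → Set ι) (hs : ∀ x, (s x).Countable) :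
    lift.{u} #(⋃ x ∈ D, s x : Set ι) ≤ max ℵ₀ (lift.{w} #D) := by
  refine (mk_biUnion_le_lift s D).trans ?_
  refine (mul_le_max _ _).trans ?_
  have h : (⨆ x : D, lift.{u} #(s x.1)) ≤ ℵ₀ := by
    refine ciSup_le' fun x => ?_
    have := (hs x.1).le_aleph0
    simpa using this
  refine max_le (max_le (le_max_right _ _) ?_) (le_max_left _ _)
  exact le_max_of_le_left (by simpa using h)

/-- One round of applying a set-valued binary operation. -/
def opStep {H : Type*} (c : H → H → Set H) (s : Set H) : Set H :=
  s ∪ ⋃ x ∈ s, ⋃ y ∈ s, c x y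

theorem opStep_mono {H : Type*} (c : H → H → Set H) : Monotone (opStep c) := by
  intro s t hst
  refine Set.union_subset_union hst ?_
  refine Set.biUnion_mono hst fun x _ => Set.biUnion_mono hst fun y _ => le_rfl

theorem exists_monotone_hull {H : Type*} (c : H → H → Set H) (hc : ∀ x y, (c x y).Countable) :
    ∃ hull : Set H → Set H, Monotone hull ∧ (∀ s, s ⊆ hull s) ∧
      (∀ s, ∀ x ∈ hull s, ∀ y ∈ hull s, c x y ⊆ hull s) ∧
      ∀ s, #(hull s) ≤ max ℵ₀ #s := by
  have hinc : ∀ s, Monotone fun n => (opStep c)^[n] s := by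
    intro s
    refine monotone_nat_of_le_succ fun n => ?_
    rw [Function.iterate_succ_apply']
    exact Set.subset_union_left
  refine ⟨fun s => ⋃ n, (opStep c)^[n] s, ?_, ?_, ?_, ?_⟩
  · intro s t hst
    exact Set.iUnion_mono fun n => (opStep_mono c).iterate n hst
  · intro s
    exact Set.subset_iUnion (fun n => (opStep c)^[n] s) 0
  · intro s x hx y hy u hu
    obtain ⟨m, hm⟩ := Set.mem_iUnion.1 hx
    obtain ⟨n, hn⟩ := Set.mem_iUnion.1 hy
    refine Set.mem_iUnion.2 ⟨max m n + 1, ?_⟩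
    rw [Function.iterate_succ_apply']
    refine Or.inr ?_
    simp only [Set.mem_iUnion]
    exact ⟨x, hinc s (le_max_left m n) hm, y, hinc s (le_max_right m n) hn, hu⟩
  · intro s
    have hstep : ∀ t : Set H, #t ≤ max ℵ₀ #s → #(opStep c t) ≤ max ℵ₀ #s := by
      intro t ht
      have hle : ℵ₀ ≤ max ℵ₀ #s := le_max_left _ _
      have hb : #(⋃ p ∈ t ×ˢ t, c p.1 p.2 : Set H) ≤ max ℵ₀ #s := by
        have h1 := Cardinal.lift_mk_biUnion_le_of_countable (t ×ˢ t)
          (fun p : H × H => c p.1 p.2) (fun p => hc _ _)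
        simp only [Cardinal.lift_id] at h1
        refine h1.trans (max_le hle ?_)
        rw [Cardinal.mk_setProd]
        exact (mul_le_mul' ht ht).trans_eq (Cardinal.mul_eq_self hle)
      have he : opStep c t = t ∪ ⋃ p ∈ t ×ˢ t, c p.1 p.2 := by
        ext u
        simp only [opStep, Set.mem_union, Set.mem_iUnion, Set.mem_prod, Prod.exists, exists_prop]
        grind
      rw [he]
      exact (Cardinal.mk_union_le _ _).trans
        ((add_le_add ht hb).trans_eq (Cardinal.add_eq_self hle))
    have hn : ∀ n, #((opStep c)^[n] s) ≤ max ℵ₀ #s := by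
      intro n
      induction n with
      | zero => exact le_max_right _ _
      | succ n ih => rw [Function.iterate_succ_apply']; exact hstep _ ih
    have h2 := Cardinal.mk_iUnion_le_lift (fun n => (opStep c)^[n] s)
    simp only [Cardinal.lift_id', Cardinal.mk_nat, Cardinal.lift_aleph0] at h2
    refine h2.trans ((mul_le_mul' (le_max_left ℵ₀ #s) (ciSup_le' hn)).trans_eq
      (Cardinal.mul_eq_self (le_max_left _ _)))

theorem card_mul_sq_le_of_pairwise_inner_eq_zero {H ι : Type*} [NormedAddCommGroup H]
    [InnerProductSpace ℝ H] (F : Finset ι) (u : ι → H) (x : H) {R δ : ℝ} (hδ : 0 < δ)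
    (hu : ∀ i ∈ F, ‖u i‖ ≤ R) (ho : ∀ i ∈ F, ∀ j ∈ F, i ≠ j → inner ℝ (u i) (u j) = 0)
    (hx : ∀ i ∈ F, δ ≤ |inner ℝ x (u i)|) :
    F.card * δ ^ 2 ≤ R ^ 2 * ‖x‖ ^ 2 := by
  have hpos : ∀ i ∈ F, 0 < ‖u i‖ := by
    intro i hi
    rw [norm_pos_iff]
    intro h
    have := hx i hi
    simp [h] at this
    linarith
  have hon : Orthonormal ℝ (fun i : F => (‖u i‖)⁻¹ • u i) := by
    refine ⟨fun i => ?_, fun i j hij => ?_⟩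
    · rw [norm_smul, norm_inv, norm_norm, inv_mul_cancel₀ (hpos i i.2).ne']
    · simp only [inner_smul_left, inner_smul_right]
      rw [ho i i.2 j j.2 (fun h => hij (Subtype.ext h))]
      simp
  have hb := hon.sum_inner_products_le (s := Finset.univ) x
  have hterm : ∀ i : F, δ ^ 2 ≤ R ^ 2 * ‖inner ℝ ((‖u i‖)⁻¹ • u i) x‖ ^ 2 := by
    intro i
    have hp := hpos i i.2
    have hR : 0 < R := hp.trans_le (hu i i.2)
    rw [← mul_pow]
    refine pow_le_pow_left₀ hδ.le ?_ 2
    rw [real_inner_smul_left, norm_mul, norm_inv, norm_norm, real_inner_comm, Real.norm_eq_abs]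
    calc δ ≤ |inner ℝ x (u i)| := hx i i.2
      _ = ‖u i‖ * (‖u i‖⁻¹ * |inner ℝ x (u i)|) := by field_simp
      _ ≤ R * (‖u i‖⁻¹ * |inner ℝ x (u i)|) := by
        gcongr
        exact hu i i.2
  calc F.card * δ ^ 2 = ∑ _i : F, δ ^ 2 := by simp
    _ ≤ ∑ i : F, R ^ 2 * ‖inner ℝ ((‖u i‖)⁻¹ • u i) x‖ ^ 2 := Finset.sum_le_sum fun i _ => hterm i
    _ = R ^ 2 * ∑ i : F, ‖inner ℝ ((‖u i‖)⁻¹ • u i) x‖ ^ 2 := by rw [Finset.mul_sum]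
    _ ≤ R ^ 2 * ‖x‖ ^ 2 := by gcongr

theorem closure_span_eq_of_rat_combination_mem {H : Type*} [NormedAddCommGroup H]
    [NormedSpace ℝ H] {D : Set H} (hne : D.Nonempty)
    (hD : ∀ x ∈ D, ∀ y ∈ D, ∀ q r : ℚ, (q : ℝ) • x + (r : ℝ) • y ∈ D) :
    ((Submodule.span ℝ D).topologicalClosure : Set H) ⊆ closure D := by
  have hadd : ∀ x ∈ closure D, ∀ y ∈ closure D, x + y ∈ closure D := fun x hx y hy =>
    map_mem_closure₂ continuous_add hx hy fun a ha b hb => by simpa using hD a ha b hb 1 1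
  have hsmul : ∀ (c : ℝ), ∀ x ∈ closure D, c • x ∈ closure D := fun c x hx =>
    map_mem_closure₂ (s := Set.range ((↑) : ℚ → ℝ)) continuous_smul
      (Rat.denseRange_cast (𝕜 := ℝ) c) hx (by
        rintro _ ⟨q, rfl⟩ b hb
        simpa using hD b hb b hb q 0)
  obtain ⟨d, hd⟩ := hne
  have h0 : (0 : H) ∈ closure D := by simpa using hsmul 0 d (subset_closure hd)
  let M : Submodule ℝ H :=
    { carrier := closure D
      add_mem' := fun {x y} hx hy => hadd x hx y hy
      zero_mem' := h0
      smul_mem' := hsmul }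
  exact Submodule.topologicalClosure_minimal (t := M) _
    (Submodule.span_le.2 subset_closure) isClosed_closure

theorem norm_map_starProjection_le {H Y : Type*} [NormedAddCommGroup H] [InnerProductSpace ℝ H]
    [CompleteSpace H] [NormedAddCommGroup Y] [NormedSpace ℝ Y] (S : H →L[ℝ] Y)
    (F : H → StrongDual ℝ Y) (hF : ∀ x, ‖F x‖ ≤ 1) (hFS : ∀ x, F x (S x) = ‖S x‖) {D : Set H}
    (hD : ∀ x ∈ D, ∀ y ∈ D, ∀ q r : ℚ, (q : ℝ) • x + (r : ℝ) • y ∈ D)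
    (hadj : ∀ x ∈ D, (InnerProductSpace.toDual ℝ H).symm ((F x).comp S) ∈ D)
    (h : H) {C : ℝ} (hC0 : 0 ≤ C) (hC : ∀ x ∈ D, F x (S h) ≤ C) :
    ‖S ((Submodule.span ℝ D).topologicalClosure.starProjection h)‖ ≤ C := by
  set V := (Submodule.span ℝ D).topologicalClosure with hV
  have hDV : D ⊆ V := Submodule.subset_span.trans (Submodule.le_topologicalClosure _)
  rcases D.eq_empty_or_nonempty with rfl | hne
  · have hbot : (V : Set H) ⊆ {0} := by
      rw [hV, Submodule.span_empty, Submodule.topologicalClosure_coe, Submodule.bot_coe,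
        closure_singleton]
    have : V.starProjection h = 0 := hbot (V.starProjection_apply_mem h)
    simpa [this] using hC0
  set z := V.starProjection h with hz
  have hzc : z ∈ closure D :=
    closure_span_eq_of_rat_combination_mem hne hD (V.starProjection_apply_mem h)
  refine le_of_forall_pos_le_add fun η hη => ?_
  obtain ⟨δ, hδ, hδη⟩ : ∃ δ > 0, 2 * ‖S‖ * δ ≤ η := by
    refine ⟨η / (2 * ‖S‖ + 1), by positivity, ?_⟩
    rw [mul_div_assoc', div_le_iff₀ (by positivity)]
    nlinarith [norm_nonneg S]
  obtain ⟨d, hd, hzd⟩ := Metric.mem_closure_iff.1 hzc δ hδ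
  have h1 : F d (S z) = F d (S h) := by
    have e : ∀ x, F d (S x) = inner ℝ ((InnerProductSpace.toDual ℝ H).symm ((F d).comp S)) x := by
      intro x; rw [InnerProductSpace.toDual_symm_apply]; rfl
    have h0 := V.starProjection_inner_eq_zero h _ (hDV (hadj d hd))
    rw [real_inner_comm, inner_sub_right, ← e, ← e] at h0
    linarith
  have h2 : ‖S (z - d)‖ ≤ ‖S‖ * δ :=
    (S.le_opNorm _).trans (by rw [dist_eq_norm] at hzd; gcongr)
  have h3 : |F d (S (z - d))| ≤ ‖S (z - d)‖ := by
    have := (F d).le_of_opNorm_le (hF d) (S (z - d))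
    simpa using this
  have h4 : ‖S z‖ ≤ ‖S (z - d)‖ + ‖S d‖ := by
    have := norm_add_le (S (z - d)) (S d)
    rwa [← map_add, sub_add_cancel] at this
  have h5 : F d (S (z - d)) = F d (S z) - F d (S d) := by simp
  have h6 := neg_abs_le (F d (S (z - d)))
  have h7 := hC d hd
  have h8 := hFS d
  linarith

section UniformlyFew

variable {ι : Type u} {Y : Type*} [NormedAddCommGroup Y] [NormedSpace ℝ Y]

/-- `B` splits into countably many pieces, the `n`-th of which contains, for every functional `f` in
the dual unit ball, at most `n` indices with `ε < |f (y i)|`. -/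
def UniformlyFewLarge (y : ι → Y) (ε : ℝ) (B : Set ι) : Prop :=
  ∃ p : ι → ℕ, ∀ n : ℕ, ∀ f : StrongDual ℝ Y, ‖f‖ ≤ 1 →
    ∀ F : Finset ι, (∀ i ∈ F, i ∈ B ∧ p i = n ∧ ε < |f (y i)|) → F.card ≤ n

theorem UniformlyFewLarge.of_bound {y : ι → Y} {ε : ℝ} {B : Set ι} (p : ι → ℕ) (c : ℕ → ℕ)
    (h : ∀ n : ℕ, ∀ f : StrongDual ℝ Y, ‖f‖ ≤ 1 →
      ∀ F : Finset ι, (∀ i ∈ F, i ∈ B ∧ p i = n ∧ ε < |f (y i)|) → F.card ≤ c n) :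
    UniformlyFewLarge y ε B := by
  refine ⟨fun i => Nat.pair (p i) (c (p i)), fun n f hf F hF => ?_⟩
  rcases F.eq_empty_or_nonempty with rfl | ⟨j, hj⟩
  · simp
  have hn := (hF j hj).2.1
  refine (h (p j) f hf F fun i hi => ⟨(hF i hi).1, ?_, (hF i hi).2.2⟩).trans
    (hn ▸ Nat.right_le_pair _ _)
  exact (Nat.pair_eq_pair.1 ((hF i hi).2.1.trans hn.symm)).1

theorem UniformlyFewLarge.of_countable {y : ι → Y} {ε : ℝ} {B : Set ι} (hB : B.Countable) :
    UniformlyFewLarge y ε B := by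
  obtain ⟨p, hp⟩ := Set.countable_iff_exists_injOn.1 hB
  refine .of_bound p (fun _ => 1) fun n f _ F hF => Finset.card_le_one.2 fun a ha b hb => ?_
  exact hp (hF a ha).1 (hF b hb).1 ((hF a ha).2.1.trans (hF b hb).2.1.symm)

theorem UniformlyFewLarge.of_fibers {W : Type*} {y : ι → Y} {ε : ℝ} {B : Set ι} (r : ι → W)
    (hfib : ∀ w, UniformlyFewLarge y ε (B ∩ r ⁻¹' {w})) (C : ℕ)
    (hC : ∀ f : StrongDual ℝ Y, ‖f‖ ≤ 1 → ∀ F : Finset ι,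
      (∀ i ∈ F, i ∈ B ∧ ε < |f (y i)|) → Set.InjOn r F → F.card ≤ C) :
    UniformlyFewLarge y ε B := by
  classical
  choose p hp using hfib
  refine .of_bound (fun i => p (r i) i) (fun n => n * C) fun n f hf F hF => ?_
  refine (Finset.card_le_mul_card_image (f := r) F n fun w _ => ?_).trans ?_
  · refine hp w n f hf _ fun i hi => ?_
    obtain ⟨hiF, rfl⟩ := Finset.mem_filter.1 hi
    exact ⟨⟨(hF i hiF).1, rfl⟩, (hF i hiF).2⟩
  · obtain ⟨G, hGF, hinj, himg⟩ := Finset.exists_subset_injOn_image_eq_of_surjOn (f := r)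
      (F : Set ι) (F.image r) (by rw [Finset.coe_image]; exact Set.surjOn_image _ _)
    rw [← himg, Finset.card_image_of_injOn hinj]
    exact Nat.mul_le_mul_left _ (hC f hf G
      (fun i hi => ⟨(hF i (hGF hi)).1, (hF i (hGF hi)).2.2⟩) hinj)

theorem UniformlyFewLarge.of_iUnion {y : ι → Y} {ε : ℝ} {B : ℕ → Set ι}
    (h : ∀ m, UniformlyFewLarge y ε (B m)) : UniformlyFewLarge y ε (⋃ m, B m) := by
  choose p hp using h
  have hm : ∀ i, ∃ m, i ∈ (⋃ m, B m) → i ∈ B m := by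
    intro i
    by_cases hi : i ∈ ⋃ m, B m
    · obtain ⟨m, hm⟩ := Set.mem_iUnion.1 hi
      exact ⟨m, fun _ => hm⟩
    · exact ⟨0, fun h => absurd h hi⟩
  choose m hm using hm
  refine .of_bound (fun i => Nat.pair (m i) (p (m i) i)) (fun n => n.unpair.2) fun n f hf F hF => ?_
  refine hp n.unpair.1 n.unpair.2 f hf F fun i hi => ?_
  obtain ⟨hiB, rfl, hlt⟩ := hF i hi
  simp only [Nat.unpair_pair]
  exact ⟨hm i hiB, trivial, hlt⟩

end UniformlyFew

theorem exists_monotone_cover_of_aleph0_lt {ι : Type u} (B : Set ι) (hB : ℵ₀ < #B) :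
    ∃ (W : Type u) (_ : LinearOrder W) (_ : WellFoundedLT W) (_ : Nonempty W) (T : W → Set ι),
      Monotone T ∧ (∀ w, #(T w) < #B) ∧ B ⊆ ⋃ w, T w := by
  obtain ⟨e⟩ : Nonempty (B ≃ (#B).ord.ToType) := Cardinal.eq.1 (Cardinal.mk_ord_toType _).symm
  have hne : Nonempty B := Cardinal.mk_ne_zero_iff.1 (Cardinal.aleph0_pos.trans hB).ne'
  refine ⟨(#B).ord.ToType, inferInstance, inferInstance, hne.map e,
    fun w => (fun x : Set.Iic w => ((e.symm x : B) : ι)) '' Set.univ, ?_, ?_, ?_⟩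
  · rintro v w hvw _ ⟨x, -, rfl⟩
    exact ⟨⟨x, x.2.trans hvw⟩, trivial, rfl⟩
  · intro w
    refine Cardinal.mk_image_le.trans_lt ?_
    rw [Cardinal.mk_univ, ← Set.Iio_insert]
    refine (Cardinal.mk_insert_le).trans_lt (Cardinal.add_lt_of_lt hB.le ?_
      (Cardinal.one_lt_aleph0.trans hB))
    have := Cardinal.mk_Iio_lt w (by simp)
    rwa [Cardinal.mk_ord_toType] at this
  · intro b hb
    exact Set.mem_iUnion.2 ⟨e ⟨b, hb⟩, ⟨⟨e ⟨b, hb⟩, Set.self_mem_Iic⟩, trivial, by simp⟩⟩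

section HilbertApprox

variable {ι : Type u} {H : Type v} {Y : Type*} [NormedAddCommGroup H] [InnerProductSpace ℝ H]
  [CompleteSpace H] [NormedAddCommGroup Y] [NormedSpace ℝ Y]

theorem exists_monotone_closed_families (S : H →L[ℝ] Y) (F : H → StrongDual ℝ Y)
    (y : ι → Y) (h : ι → H) (hcount : ∀ f : StrongDual ℝ Y, {i | f (y i) ≠ 0}.Countable) :
    ∃ (D : Set ι → Set H) (G : Set ι → Set ι), Monotone D ∧ Monotone G ∧
      (∀ s, ∀ x ∈ D s, ∀ z ∈ D s, ∀ q r : ℚ, (q : ℝ) • x + (r : ℝ) • z ∈ D s) ∧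
      (∀ s, ∀ x ∈ D s, (InnerProductSpace.toDual ℝ H).symm ((F x).comp S) ∈ D s) ∧
      (∀ s, s ⊆ G s) ∧ (∀ s, ∀ i ∈ G s, h i ∈ D s) ∧
      (∀ s, ∀ i ∉ G s, ∀ x ∈ D s, F x (y i) = 0) ∧
      ∀ s, #(G s) ≤ max ℵ₀ #s := by
  let c : H → H → Set H := fun x z =>
    Set.range (fun q : ℚ × ℚ => (q.1 : ℝ) • x + (q.2 : ℝ) • z) ∪
      ({(InnerProductSpace.toDual ℝ H).symm ((F x).comp S)} ∪ h '' {i | F x (y i) ≠ 0})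
  have hc : ∀ x z, (c x z).Countable := fun x z =>
    (Set.countable_range _).union ((Set.countable_singleton _).union ((hcount _).image _))
  obtain ⟨hull, hmono, hsub, hclosed, hcard⟩ := exists_monotone_hull c hc
  refine ⟨fun s => hull (h '' s), fun s => s ∪ ⋃ x ∈ hull (h '' s), {i | F x (y i) ≠ 0},
    ?_, ?_, ?_, ?_, ?_, ?_, ?_, ?_⟩
  · exact fun s t hst => hmono (Set.image_mono hst)
  · exact fun s t hst => Set.union_subset_union hst
      (Set.biUnion_mono (hmono (Set.image_mono hst)) fun _ _ => le_rfl)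
  · exact fun s x hx z hz q r => hclosed _ x hx z hz (Or.inl ⟨(q, r), rfl⟩)
  · exact fun s x hx => hclosed _ x hx x hx (Or.inr (Or.inl rfl))
  · exact fun s => Set.subset_union_left
  · rintro s i (hi | hi)
    · exact hsub _ ⟨i, hi, rfl⟩
    · simp only [Set.mem_iUnion] at hi
      obtain ⟨x, hx, hi⟩ := hi
      exact hclosed _ x hx x hx (Or.inr (Or.inr ⟨i, hi, rfl⟩))
  · intro s i hi x hx
    by_contra hne
    exact hi (Or.inr (Set.mem_biUnion hx hne))
  · intro s
    have hle : ℵ₀ ≤ max ℵ₀ #s := le_max_left _ _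
    have h1 := Cardinal.lift_mk_biUnion_le_of_countable (hull (h '' s))
      (fun x => {i | F x (y i) ≠ 0}) fun x => hcount _
    have h2 : Cardinal.lift.{u} #(hull (h '' s)) ≤ Cardinal.lift.{v} (max ℵ₀ #s) := by
      refine (Cardinal.lift_le.2 (hcard _)).trans ?_
      simp only [Cardinal.lift_max, Cardinal.lift_aleph0]
      exact max_le_max le_rfl Cardinal.mk_image_le_lift
    have h3 := Cardinal.lift_le.1 (h1.trans (max_le
      (by simp only [Cardinal.lift_max, Cardinal.lift_aleph0]; exact le_max_left _ _) h2))
    exact (Cardinal.mk_union_le _ _).trans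
      ((add_le_add (le_max_right _ _) h3).trans_eq (Cardinal.add_eq_self hle))

theorem UniformlyFewLarge.of_bounded_approx (S : H →L[ℝ] Y) (y : ι → Y) (h : ι → H)
    {ε R : ℝ} (hε : 0 < ε) (hR : ∀ i, ‖h i‖ ≤ R) (hSh : ∀ i, ‖S (h i) - y i‖ ≤ ε / 4)
    (hcount : ∀ f : StrongDual ℝ Y, {i | f (y i) ≠ 0}.Countable) (B : Set ι) :
    UniformlyFewLarge y ε B := by
  obtain ⟨F, hF⟩ : ∃ F : H → StrongDual ℝ Y, ∀ x, ‖F x‖ ≤ 1 ∧ F x (S x) = ‖S x‖ :=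
    ⟨_, fun x => (exists_dual_vector'' ℝ (S x)).choose_spec⟩
  obtain ⟨D, G, hDmono, hGmono, hcomb, hadj, hsG, hGD, hGF, hGcard⟩ :=
    exists_monotone_closed_families S F y h hcount
  induction hκ : #B using WellFoundedLT.induction generalizing B with
  | ind κ ih =>
  subst hκ
  rcases le_or_gt #B ℵ₀ with hB | hB
  · exact .of_countable (Cardinal.le_aleph0_iff_set_countable.1 hB)
  obtain ⟨W, _, _, _, T, hT, hTcard, hTB⟩ := exists_monotone_cover_of_aleph0_lt B hB
  have hr : ∀ i, ∃ w, i ∈ B → i ∈ G (T w) ∧ ∀ v < w, i ∉ G (T v) := by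
    intro i
    by_cases hi : i ∈ B
    · obtain ⟨w, hw⟩ := Set.mem_iUnion.1 (hTB hi)
      obtain ⟨w, hw, hmin⟩ := WellFounded.has_min (wellFounded_lt (α := W)) {w | i ∈ G (T w)}
        ⟨w, hsG _ hw⟩
      exact ⟨w, fun _ => ⟨hw, fun v hv hiv => hmin v hiv hv⟩⟩
    · exact ⟨Classical.arbitrary W, fun h => absurd h hi⟩
  choose r hr using hr
  let U : W → Set H := fun w => ⋃ v ∈ Set.Iio w, D (T v)
  let V : W → Submodule ℝ H := fun w => (Submodule.span ℝ (U w)).topologicalClosure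
  have hUV : ∀ w, U w ⊆ V w := fun w =>
    Submodule.subset_span.trans (Submodule.le_topologicalClosure _)
  have hVD : ∀ {v w}, v < w → D (T v) ⊆ V w := fun {v w} hvw =>
    (Set.subset_biUnion_of_mem (u := fun v => D (T v)) (Set.mem_Iio.2 hvw)).trans (hUV w)
  have hVV : ∀ {v w}, v ≤ w → V v ≤ V w := fun {v w} hvw =>
    Submodule.topologicalClosure_mono (Submodule.span_mono
      (Set.biUnion_mono (Set.Iio_subset_Iio hvw) fun _ _ => le_rfl))
  have hproj : ∀ i ∈ B, ‖S ((V (r i)).starProjection (h i))‖ ≤ ε / 4 := by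
    intro i hi
    refine norm_map_starProjection_le S F (fun x => (hF x).1) (fun x => (hF x).2)
      ?_ ?_ (h i) (by positivity) ?_
    · intro x hx z hz q s
      simp only [U, Set.mem_iUnion, Set.mem_Iio, exists_prop] at hx hz ⊢
      obtain ⟨v, hv, hx⟩ := hx
      obtain ⟨v', hv', hz⟩ := hz
      exact ⟨max v v', max_lt hv hv', hcomb _ x (hDmono (hT (le_max_left _ _)) hx) z
        (hDmono (hT (le_max_right _ _)) hz) q s⟩
    · intro x hx
      simp only [U, Set.mem_iUnion, Set.mem_Iio, exists_prop] at hx ⊢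
      obtain ⟨v, hv, hx⟩ := hx
      exact ⟨v, hv, hadj _ x hx⟩
    · intro x hx
      simp only [U, Set.mem_iUnion, Set.mem_Iio, exists_prop] at hx
      obtain ⟨v, hv, hx⟩ := hx
      have h0 := hGF _ i ((hr i hi).2 v hv) x hx
      have h1 : |F x (S (h i) - y i)| ≤ ε / 4 :=
        ((F x).le_of_opNorm_le (hF x).1 _).trans (by simpa using hSh i)
      rw [map_sub, h0, sub_zero] at h1
      exact (le_abs_self _).trans h1
  let g : ι → H := fun i => h i - (V (r i)).starProjection (h i)
  have hgR : ∀ i, ‖g i‖ ≤ R := by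
    intro i
    have : g i = (V (r i))ᗮ.starProjection (h i) := by
      rw [Submodule.starProjection_orthogonal_val]
    rw [this]
    exact (Submodule.norm_starProjection_apply_le _ _).trans (hR i)
  have hgV : ∀ i ∈ B, ∀ w, r i < w → g i ∈ V w := fun i hi w hw =>
    sub_mem (hVD hw (hGD _ i (hr i hi).1)) (hVV hw.le (Submodule.starProjection_apply_mem _ _))
  have hortho : ∀ i ∈ B, ∀ j, r i < r j → inner ℝ (g j) (g i) = 0 := fun i hi j hij =>
    Submodule.starProjection_inner_eq_zero _ _ (hgV i hi _ hij)
  have hlarge : ∀ i ∈ B, ∀ f : StrongDual ℝ Y, ‖f‖ ≤ 1 → ε < |f (y i)| →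
      ε / 2 ≤ |inner ℝ ((InnerProductSpace.toDual ℝ H).symm (f.comp S)) (g i)| := by
    intro i hi f hf hlt
    have e : inner ℝ ((InnerProductSpace.toDual ℝ H).symm (f.comp S)) (g i) =
        f (y i) + f (S (h i) - y i) - f (S ((V (r i)).starProjection (h i))) := by
      rw [InnerProductSpace.toDual_symm_apply]
      simp [g]
    have h1 : |f (S (h i) - y i)| ≤ ε / 4 :=
      (f.le_of_opNorm_le hf _).trans (by simpa using hSh i)
    have h2 : |f (S ((V (r i)).starProjection (h i)))| ≤ ε / 4 :=
      (f.le_of_opNorm_le hf _).trans (by simpa using hproj i hi)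
    rw [e]
    rw [abs_le] at h1 h2
    rcases lt_abs.1 hlt with h3 | h3
    · exact le_trans (by linarith) (le_abs_self _)
    · exact le_trans (by linarith) (neg_le_abs _)
  refine .of_fibers r (fun w => ih _ ?_ _ rfl) ⌈R ^ 2 * ‖S‖ ^ 2 / (ε / 2) ^ 2⌉₊ ?_
  · refine lt_of_le_of_lt (Cardinal.mk_le_mk_of_subset ?_)
      ((hGcard (T w)).trans_lt (max_lt hB (hTcard w)))
    rintro i ⟨hi, rfl⟩
    exact (hr i hi).1
  · intro f hf E hE hinj
    have hb := card_mul_sq_le_of_pairwise_inner_eq_zero E g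
      ((InnerProductSpace.toDual ℝ H).symm (f.comp S)) (half_pos hε) (fun i _ => hgR i)
      (fun i hi j hj hij => by
        rcases lt_trichotomy (r i) (r j) with hlt | heq | hlt
        · rw [real_inner_comm]; exact hortho i (hE i hi).1 j hlt
        · exact absurd (hinj hi hj heq) hij
        · exact hortho j (hE j hj).1 i hlt)
      (fun i hi => hlarge i (hE i hi).1 f hf (hE i hi).2)
    have hn : ‖(InnerProductSpace.toDual ℝ H).symm (f.comp S)‖ ≤ ‖S‖ := by
      rw [LinearIsometryEquiv.norm_map]
      refine (f.opNorm_comp_le S).trans ?_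
      exact mul_le_of_le_one_left (norm_nonneg _) hf
    have hc : (E.card : ℝ) ≤ R ^ 2 * ‖S‖ ^ 2 / (ε / 2) ^ 2 := by
      rw [le_div_iff₀ (by positivity)]
      exact hb.trans (by gcongr)
    exact_mod_cast hc.trans (Nat.le_ceil _)

theorem UniformlyFewLarge.of_denseRange (S : H →L[ℝ] Y) (hS : DenseRange S) (y : ι → Y)
    (hcount : ∀ f : StrongDual ℝ Y, {i | f (y i) ≠ 0}.Countable) {ε : ℝ} (hε : 0 < ε) :
    UniformlyFewLarge y ε Set.univ := by
  have hh : ∀ i, ∃ x, ‖S x - y i‖ ≤ ε / 4 := fun i => by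
    obtain ⟨x, hx⟩ := hS.exists_dist_lt (y i) (show 0 < ε / 4 by positivity)
    exact ⟨x, by rw [← dist_eq_norm, dist_comm]; exact hx.le⟩
  choose h hh using hh
  have hu : (Set.univ : Set ι) = ⋃ m : ℕ, {i | ‖h i‖ ≤ m} := by
    ext i
    simpa using exists_nat_ge ‖h i‖
  rw [hu]
  refine .of_iUnion fun m => ?_
  have key := UniformlyFewLarge.of_bounded_approx (ι := {i // ‖h i‖ ≤ m}) S (fun i => y i)
    (fun i => h i) hε (fun i => i.2) (fun i => hh i)
    (fun f => (hcount f).preimage Subtype.val_injective) Set.univ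
  classical
  obtain ⟨p, hp⟩ := key
  refine ⟨fun i => if hi : ‖h i‖ ≤ m then p ⟨i, hi⟩ else 0, fun n f hf F hF => ?_⟩
  have := hp n f hf (F.subtype fun i => ‖h i‖ ≤ m) fun i hi => by
    obtain ⟨h1, h2, h3⟩ := hF i (Finset.mem_subtype.1 hi)
    refine ⟨trivial, ?_, h3⟩
    simpa only [dif_pos i.2] using h2
  rwa [Finset.card_subtype, Finset.filter_true_of_mem (p := fun i => ‖h i‖ ≤ m)
    fun i hi => (hF i hi).1] at this

end HilbertApprox

theorem countable_setOf_apply_ne_zero {X : Type*} [NormedAddCommGroup X] [NormedSpace ℝ X]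
    (A : Set X) (hcomp : IsCompact (toWeakSpace ℝ X '' (A ∪ {0})))
    (hcluster : ∀ z : X,
      ClusterPt (toWeakSpace ℝ X z) (Filter.principal (toWeakSpace ℝ X '' (A \ {z}))) → z = 0)
    (f : StrongDual ℝ X) : {x ∈ A | f x ≠ 0}.Countable := by
  have hfin : ∀ k : ℕ, {x ∈ A | 1 / ((k : ℝ) + 1) ≤ |f x|}.Finite := by
    intro k
    by_contra hinf
    set E := {x ∈ A | 1 / ((k : ℝ) + 1) ≤ |f x|} with hE
    have hinf' : (toWeakSpace ℝ X '' E).Infinite :=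
      Set.Infinite.image (toWeakSpace ℝ X).injective.injOn hinf
    obtain ⟨z, -, hz⟩ := hinf'.exists_accPt_of_subset_isCompact hcomp
      (Set.image_mono fun x hx => Or.inl hx.1)
    obtain ⟨z, rfl⟩ := (toWeakSpace ℝ X).surjective z
    rw [accPt_principal_iff_clusterPt] at hz
    have hz0 : z = 0 := by
      refine hcluster z (hz.mono (Filter.principal_mono.2 ?_))
      rintro _ ⟨⟨x, hx, rfl⟩, hne⟩
      exact ⟨x, ⟨hx.1, fun h => hne (by rw [Set.mem_singleton_iff.1 h]; rfl)⟩, rfl⟩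
    have hcont : Continuous fun x : WeakSpace ℝ X => |f ((toWeakSpace ℝ X).symm x)| :=
      continuous_abs.comp (WeakBilin.eval_continuous (topDualPairing ℝ X).flip f)
    have hcl : IsClosed {x : WeakSpace ℝ X | 1 / ((k : ℝ) + 1) ≤ |f ((toWeakSpace ℝ X).symm x)|} :=
      isClosed_le continuous_const hcont
    have hmem := isClosed_iff_clusterPt.1 hcl _ (hz.mono (Filter.principal_mono.2 (by
      rintro _ ⟨⟨x, hx, rfl⟩, -⟩
      simpa using hx.2)))
    subst hz0
    simp only [Set.mem_ofPred_eq, map_zero, abs_zero] at hmem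
    have : 0 < 1 / ((k : ℝ) + 1) := by positivity
    linarith
  refine (Set.countable_iUnion fun k => (hfin k).countable).mono fun x hx => ?_
  obtain ⟨k, hk⟩ := exists_nat_one_div_lt (abs_pos.2 hx.2)
  exact Set.mem_iUnion.2 ⟨k, hx.1, hk.le⟩

end

/-- Let `Y` be a Hilbert generated real Banach space, `X ⊆ Y` a closed subspace and
`A ⊆ X` a bounded set such that `A ∪ {0}` is weakly compact and `0` is the only weak cluster
point of `A`. Then for every `ε > 0` there is a decomposition `A = ⋃ₙ Aₙ` such that for every `n`
and every `x*` in the closed unit ball of `X*`, the set `{x ∈ Aₙ : |x*(x)| > ε}` has at most `n`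
elements (here `Aₙ` is indexed from `0`, with bound `n + 1`). -/
theorem statement12 {Y : Type*} [NormedAddCommGroup Y] [NormedSpace ℝ Y] [CompleteSpace Y]
    (hHG : ∃ (H : Type v) (_ : NormedAddCommGroup H) (_ : InnerProductSpace ℝ H)
      (_ : CompleteSpace H) (S : H →L[ℝ] Y), DenseRange S)
    (X : Subspace ℝ Y) (hX : IsClosed (X : Set Y))
    (A : Set X) (hA : Bornology.IsBounded A)
    (hcomp : IsCompact (toWeakSpace ℝ X '' (A ∪ {0})))
    (hcluster : ∀ z : X,
      ClusterPt (toWeakSpace ℝ X z) (Filter.principal (toWeakSpace ℝ X '' (A \ {z}))) →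
        z = 0) :
    ∀ ε : ℝ, 0 < ε → ∃ As : ℕ → Set X, A = ⋃ n, As n ∧
      ∀ n : ℕ, ∀ f : X →L[ℝ] ℝ, ‖f‖ ≤ 1 →
        {x ∈ As n | ε < |f x|}.encard ≤ ((n + 1 : ℕ) : ℕ∞) := by
  obtain ⟨H, _, _, _, S, hS⟩ := hHG
  intro ε hε
  have hcount : ∀ f : StrongDual ℝ Y, {i : A | f ((i : X) : Y) ≠ 0}.Countable := fun f =>
    ((countable_setOf_apply_ne_zero A hcomp hcluster (f.comp X.subtypeL)).preimage
      Subtype.val_injective).mono fun i hi => show _ ∧ _ from ⟨i.2, hi⟩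
  obtain ⟨p, hp⟩ := UniformlyFewLarge.of_denseRange S hS (fun i : A => ((i : X) : Y)) hcount hε
  refine ⟨fun n => Subtype.val '' {i : A | p i = n}, ?_, fun n f hf => ?_⟩
  · ext x
    simp
  · obtain ⟨g, hg, hgn⟩ := exists_extension_norm_eq X f
    have hsub : {x ∈ Subtype.val '' {i : A | p i = n} | ε < |f x|} =
        Subtype.val '' {i : A | p i = n ∧ ε < |f i|} := by
      ext x
      simp only [Set.mem_ofPred_eq, Set.mem_image]
      constructor
      · rintro ⟨⟨i, hi, rfl⟩, hx⟩
        exact ⟨i, ⟨hi, hx⟩, rfl⟩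
      · rintro ⟨i, ⟨hi, hx⟩, rfl⟩
        exact ⟨⟨i, hi, rfl⟩, hx⟩
    rw [hsub, Subtype.val_injective.encard_image]
    by_contra! hlt
    obtain ⟨t, hts, htc⟩ := Set.exists_subset_encard_eq hlt.le
    have htfin : t.Finite := Set.finite_of_encard_eq_coe htc
    have hle := hp n g (hgn.trans_le hf) htfin.toFinset fun i hi => by
      obtain ⟨h1, h2⟩ := hts (htfin.mem_toFinset.1 hi)
      exact ⟨trivial, h1, by rwa [hg]⟩
    rw [htfin.encard_eq_coe_toFinset_card, Nat.cast_inj] at htc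
    omega
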